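/- Landau level eigenfunctions of the single-electron Landau Hamiltonian: let ℏ, e, B, m_e > 0, ω_c = eB/m_e, n ∈ ℕ and k ∈ ℝ, and define φ_{n,k} : ℝ² → ℂ by φ_{n,k}(x,y) = exp(ikx) v_{n,k}(y). Then φ_{n,k} is smooth and satisfies, for every (x,y) ∈ ℝ², (1/(2m_e)) [ −ℏ² ∂²φ_{n,k}/∂x²(x,y) + 2iℏeB y ∂φ_{n,k}/∂x(x,y) + e²B²y² φ_{n,k}(x,y) − ℏ² ∂²φ_{n,k}/∂y²(x,y) ] = (n + 1/2) ℏ ω_c φ_{n,k}(x,y); that is, φ_{n,k} is an eigenfunction of the Landau Hamiltonian (1/(2m_e))[(−iℏ∂_x − eBy)² + (−iℏ∂_y)²] with eigenvalue (n + 1/2)ℏω_c. -/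

import Mathlib

open Real

noncomputable def physHermite : ℕ → Polynomial ℝ
  | 0 => 1
  | n + 1 => 2 * Polynomial.X * physHermite n - Polynomial.derivative (physHermite n)

/-- The harmonic-oscillator profile function `v_{n,k}` with center `yk` and magnetic
length `lB` (normalization constant `Nn`). -/
noncomputable def landauV (Nn lB : ℝ) (n : ℕ) (yk y : ℝ) : ℝ :=
  Nn * Real.exp (-(y - yk) ^ 2 / (2 * lB ^ 2)) * (physHermite n).eval ((y - yk) / lB)

/-- The Landau level eigenfunction `φ_{n,k}(x,y) = e^{ikx} v_{n,k}(y)` on the plane. -/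
noncomputable def landauPhi (Nn lB : ℝ) (n : ℕ) (yk k : ℝ) (x y : ℝ) : ℂ :=
  Complex.exp (Complex.I * ((k * x : ℝ) : ℂ)) * ((landauV Nn lB n yk y : ℝ) : ℂ)

open Polynomial in
theorem derivative_derivative_physHermite (n : ℕ) :
    derivative (derivative (physHermite n)) =
      2 * X * derivative (physHermite n) - 2 * (n : ℝ[X]) * physHermite n := by
  induction n with
  | zero => simp [physHermite]
  | succ n ih =>
    have h : derivative (physHermite (n + 1)) = 2 * ((n : ℝ[X]) + 1) * physHermite n := by
      simp only [physHermite, derivative_sub, derivative_mul, derivative_X, derivative_ofNat, ih]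
      ring
    rw [h]
    simp only [derivative_mul, derivative_add, derivative_natCast, derivative_one,
      derivative_ofNat, physHermite]
    push_cast
    ring

open Polynomial in
theorem hasDerivAt_gaussian_mul_eval (c a : ℝ) {l : ℝ} (hl : l ≠ 0) (P : ℝ[X]) (y : ℝ) :
    HasDerivAt (fun y => c * Real.exp (-(y - a) ^ 2 / (2 * l ^ 2)) * P.eval ((y - a) / l))
      (c / l * Real.exp (-(y - a) ^ 2 / (2 * l ^ 2)) *
        (derivative P - X * P).eval ((y - a) / l)) y := by
  have hy : HasDerivAt (fun y => y - a) 1 y := (hasDerivAt_id y).sub_const a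
  have hP := (P.hasDerivAt ((y - a) / l)).comp y (hy.div_const l)
  have hE := (((hy.pow 2).neg.div_const (2 * l ^ 2)).exp).const_mul c
  refine (hE.mul hP).congr_deriv ?_
  simp only [eval_sub, eval_mul, eval_X, Pi.neg_apply, Pi.pow_apply, Function.comp_apply]
  field_simp
  ring

theorem exists_hasDerivAt_landauV (c a : ℝ) {l : ℝ} (hl : l ≠ 0) (n : ℕ) :
    ∃ w : ℝ → ℝ, ∀ y, HasDerivAt (landauV c l n a) (w y) y ∧
      HasDerivAt w ((((y - a) / l) ^ 2 - (2 * n + 1)) / l ^ 2 * landauV c l n a y) y := by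
  refine ⟨_, fun y => ⟨hasDerivAt_gaussian_mul_eval c a hl (physHermite n) y,
    (hasDerivAt_gaussian_mul_eval (c / l) a hl _ y).congr_deriv ?_⟩⟩
  simp only [landauV, Polynomial.derivative_sub, Polynomial.derivative_mul,
    Polynomial.derivative_X, derivative_derivative_physHermite, Polynomial.eval_sub,
    Polynomial.eval_mul, Polynomial.eval_add, Polynomial.eval_X, Polynomial.eval_one,
    Polynomial.eval_ofNat, Polynomial.eval_natCast]
  field_simp
  ring

theorem contDiff_landauV (c l : ℝ) (n : ℕ) (a : ℝ) :
    ContDiff ℝ (⊤ : ℕ∞) (landauV c l n a) := by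
  have hP : ContDiff ℝ (⊤ : ℕ∞) fun y : ℝ => (physHermite n).eval ((y - a) / l) :=
    ((physHermite n).contDiff_aeval _).comp (by fun_prop)
  unfold landauV
  fun_prop

theorem contDiff_landauPhi (c l : ℝ) (n : ℕ) (a k : ℝ) :
    ContDiff ℝ (⊤ : ℕ∞) fun p : ℝ × ℝ => landauPhi c l n a k p.1 p.2 := by
  have hV : ContDiff ℝ (⊤ : ℕ∞) fun p : ℝ × ℝ => ((landauV c l n a p.2 : ℝ) : ℂ) :=
    Complex.ofRealCLM.contDiff.comp ((contDiff_landauV c l n a).comp contDiff_snd)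
  have hx : ContDiff ℝ (⊤ : ℕ∞) fun p : ℝ × ℝ => ((k * p.1 : ℝ) : ℂ) :=
    Complex.ofRealCLM.contDiff.comp (contDiff_const.mul contDiff_fst)
  exact (contDiff_const.mul hx).cexp.mul hV

theorem hasDerivAt_landauPhi_fst (c l : ℝ) (n : ℕ) (a k x y : ℝ) :
    HasDerivAt (fun x => landauPhi c l n a k x y)
      (Complex.I * k * landauPhi c l n a k x y) x := by
  have hx : HasDerivAt (fun x : ℝ => ((k * x : ℝ) : ℂ)) (k : ℂ) x := by
    simpa using ((hasDerivAt_id x).const_mul k).ofReal_comp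
  refine ((hx.const_mul Complex.I).cexp.mul_const _).congr_deriv ?_
  simp only [landauPhi]
  ring

theorem deriv_deriv_landauPhi_fst (c l : ℝ) (n : ℕ) (a k x y : ℝ) :
    deriv (fun x' => deriv (fun x'' => landauPhi c l n a k x'' y) x') x =
      -(k : ℂ) ^ 2 * landauPhi c l n a k x y := by
  simp only [fun x => (hasDerivAt_landauPhi_fst c l n a k x y).deriv]
  rw [((hasDerivAt_landauPhi_fst c l n a k x y).const_mul _).deriv]
  linear_combination (k : ℂ) ^ 2 * landauPhi c l n a k x y * Complex.I_sq

theorem deriv_deriv_landauPhi_snd (c : ℝ) {l : ℝ} (hl : l ≠ 0) (n : ℕ) (a k x y : ℝ) :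
    deriv (fun y' => deriv (fun y'' => landauPhi c l n a k x y'') y') y =
      (((((y - a) / l) ^ 2 - (2 * n + 1)) / l ^ 2 : ℝ) : ℂ) * landauPhi c l n a k x y := by
  obtain ⟨w, hw⟩ := exists_hasDerivAt_landauV c a hl n
  simp only [landauPhi, fun y => ((hw y).1.ofReal_comp.const_mul
    (Complex.exp (Complex.I * ((k * x : ℝ) : ℂ)))).deriv]
  rw [((hw y).2.ofReal_comp.const_mul _).deriv, Complex.ofReal_mul (_ / _)]
  ring

/-- **Landau level eigenfunctions of the single-electron Landau Hamiltonian:**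
`φ_{n,k}` is smooth and
`(1/2mₑ)[−ℏ²∂ₓ²φ + 2iℏeBy ∂ₓφ + e²B²y²φ − ℏ²∂_y²φ] = (n + 1/2) ℏ ω_c φ`. -/
theorem landauPhi_eigenfunction
    (hbar e B me : ℝ) (hhbar : 0 < hbar) (he : 0 < e) (hB : 0 < B) (hme : 0 < me)
    (n : ℕ) (k : ℝ) (Nn : ℝ) (hNn : 0 < Nn) :
    ContDiff ℝ (⊤ : ℕ∞) (fun p : ℝ × ℝ =>
      landauPhi Nn (Real.sqrt (hbar / (e * B))) n (hbar * k / (e * B)) k p.1 p.2)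
    ∧ ∀ x y : ℝ,
      (1 / (2 * (me : ℂ))) *
        (-(hbar : ℂ) ^ 2 *
            deriv (fun x' : ℝ => deriv (fun x'' : ℝ =>
              landauPhi Nn (Real.sqrt (hbar / (e * B))) n (hbar * k / (e * B)) k x'' y) x') x
          + 2 * Complex.I * (hbar : ℂ) * (e : ℂ) * (B : ℂ) * (y : ℂ) *
            deriv (fun x' : ℝ =>
              landauPhi Nn (Real.sqrt (hbar / (e * B))) n (hbar * k / (e * B)) k x' y) x
          + (e : ℂ) ^ 2 * (B : ℂ) ^ 2 * (y : ℂ) ^ 2 *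
            landauPhi Nn (Real.sqrt (hbar / (e * B))) n (hbar * k / (e * B)) k x y
          - (hbar : ℂ) ^ 2 *
            deriv (fun y' : ℝ => deriv (fun y'' : ℝ =>
              landauPhi Nn (Real.sqrt (hbar / (e * B))) n (hbar * k / (e * B)) k x y'') y') y)
      = ((n : ℂ) + 1 / 2) * (hbar : ℂ) * ((e * B / me : ℝ) : ℂ) *
          landauPhi Nn (Real.sqrt (hbar / (e * B))) n (hbar * k / (e * B)) k x y := by
  refine ⟨contDiff_landauPhi _ _ _ _ _, fun x y => ?_⟩
  have hl : Real.sqrt (hbar / (e * B)) ≠ 0 := by positivity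
  have hl2 : Real.sqrt (hbar / (e * B)) ^ 2 = hbar / (e * B) := Real.sq_sqrt (by positivity)
  rw [deriv_deriv_landauPhi_fst, deriv_deriv_landauPhi_snd _ hl,
    (hasDerivAt_landauPhi_fst _ _ _ _ _ _ _).deriv, div_pow, hl2]
  generalize landauPhi _ _ _ _ _ _ _ = φ
  have hhbar' : (hbar : ℂ) ≠ 0 := mod_cast hhbar.ne'
  have he' : (e : ℂ) ≠ 0 := mod_cast he.ne'
  have hB' : (B : ℂ) ≠ 0 := mod_cast hB.ne'
  have hme' : (me : ℂ) ≠ 0 := mod_cast hme.ne'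
  push_cast
  field_simp
  ring_nf
  simp only [Complex.I_sq]
  ring
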